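/- arXiv:math/0512042 — 2 statements merged into one kernel-verified Lean document; each statement's English description precedes it below -/
import Mathlib

section
/- Let F be a free group and let |s| denote the length of the reduced word of s ∈ F. If s ≠ e (the identity), then |s²| > |s|; in particular s² ≠ e. -/
/-- In a free group, if `s ≠ 1` then the reduced word length of `s²`
is strictly greater than that of `s`; in particular `s² ≠ 1`. -/
theorem freeGroup_norm_sq_gt {α : Type} [DecidableEq α] [Nonempty α]
    (s : FreeGroup α) (hs : s ≠ 1) :
    FreeGroup.norm s < FreeGroup.norm (s * s) ∧ s * s ≠ 1 := by
  have key : FreeGroup.norm s < FreeGroup.norm (s * s) := by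
    have h1 := FreeGroup.reduceCyclically.conj_conjugator_reduceCyclically s.toWord
    have h2 := FreeGroup.reduceCyclically.reduce_flatten_replicate_succ
      (FreeGroup.isReduced_toWord (x := s)) 1
    rw [← FreeGroup.toWord_pow, pow_succ, pow_one] at h2
    have l1 := congrArg List.length h1
    have l2 := congrArg List.length h2
    simp [FreeGroup.invRev_length] at l1 l2
    have hpos : FreeGroup.reduceCyclically s.toWord ≠ [] := by
      intro h0
      rw [h0, List.append_nil] at h1
      apply hs
      rw [← FreeGroup.mk_toWord (x := s), ← h1, ← FreeGroup.mul_mk, ← FreeGroup.inv_mk,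
        mul_inv_cancel]
    have := List.length_pos_of_ne_nil hpos
    unfold FreeGroup.norm
    omega
  refine ⟨key, fun h => ?_⟩
  rw [h, FreeGroup.norm_one] at key
  omega
end

section
/- If G is a chordal simple graph and v₁, v₂ are two distinct nonadjacent vertices of G, then the set of all vertices adjacent both to v₁ and to v₂ is a clique in G. -/
/-- A cycle (closed walk) `w` in `G` has a chord if two of its vertices are adjacent in `G`
but the corresponding edge is not an edge of the cycle (i.e. the two vertices are
nonconsecutive on the cycle). -/
def SimpleGraph.Walk.HasChord {V : Type*} {G : SimpleGraph V} {v : V}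
    (w : G.Walk v v) : Prop :=
  ∃ x y : V, x ∈ w.support ∧ y ∈ w.support ∧ G.Adj x y ∧ s(x, y) ∉ w.edges

/-- A simple graph is chordal if every cycle of length at least 4 has a chord,
i.e. it contains no minimal (induced) cycles of length `> 3`. -/
def SimpleGraph.IsChordalGraph {V : Type*} (G : SimpleGraph V) : Prop :=
  ∀ (v : V) (w : G.Walk v v), w.IsCycle → 4 ≤ w.length → w.HasChord

/-- If `G` is chordal and `v₁ ≠ v₂` are nonadjacent vertices, then the set
of common neighbours of `v₁` and `v₂` is a clique in `G`. -/
theorem chordal_common_neighbors_clique {V : Type*} (G : SimpleGraph V)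
    (hG : G.IsChordalGraph) (v₁ v₂ : V) (hne : v₁ ≠ v₂) (hnadj : ¬ G.Adj v₁ v₂) :
    G.IsClique {w : V | G.Adj v₁ w ∧ G.Adj v₂ w} := by
  rintro a ⟨h1a, h2a⟩ b ⟨h1b, h2b⟩ hab
  by_contra hn
  have c := hG v₁ (.cons h1a (.cons h2a.symm (.cons h2b (.cons h1b.symm .nil)))) (by
    have := h1a.ne
    have := h2a.ne
    have := h1b.ne
    have := h2b.ne
    rw [SimpleGraph.Walk.cons_isCycle_iff]
    simp [SimpleGraph.Walk.isPath_def]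
    grind) (by simp)
  obtain ⟨x, y, hx, hy, hadj, he⟩ := c
  have hxy := hadj.ne
  have hs := hadj.symm
  simp at hx hy he
  grind
end
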